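/- Let t be the Tribonacci word and, for i ≥ 1, let n_i = Σ_{j=0}^{i} F_{2j} = F_0 + F_2 + ⋯ + F_{2i}. Then for every i ≥ 1, P^rel_t(n_i) = { (0,0,0), (−1,1,0), (0,1,−1), (−1,0,1) } (vectors in ℤ^3 indexed by the letters 0, 1, 2), and consequently AC_t(n_i) = 4; in particular, the abelian complexity of the Tribonacci word attains the value 4 infinitely many times. -/

import Mathlib

/-- The prefix of length `n` of the infinite word `u`. -/
def pref (u : ℕ → ℕ) (n : ℕ) : List ℕ := (List.range n).map u

/-- `w` is a factor of the infinite word `u`. -/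
def IsFactor (u : ℕ → ℕ) (w : List ℕ) : Prop :=
  ∃ i : ℕ, w = (List.range w.length).map (fun j => u (i + j))

/-- The Parikh vector of `w`, viewed as a word over `{0, …, m-1}`. -/
def parikh (m : ℕ) (w : List ℕ) : Fin m → ℤ := fun ℓ => (w.count (ℓ : ℕ) : ℤ)

/-- The set of relative Parikh vectors of factors of `u` of length `n`. -/
def relParikhSet (m : ℕ) (u : ℕ → ℕ) (n : ℕ) : Set (Fin m → ℤ) :=
  { v | ∃ w : List ℕ, IsFactor u w ∧ w.length = n ∧ v = parikh m w - parikh m (pref u n) }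

/-- The extension of a substitution `φ` to finite words. -/
def substW (φ : ℕ → List ℕ) (w : List ℕ) : List ℕ := w.flatMap φ

/-- The `k`-th iterate of the substitution `φ`, applied to the word `w`. -/
def iterW (φ : ℕ → List ℕ) (k : ℕ) (w : List ℕ) : List ℕ := (substW φ)^[k] w

/-- The Tribonacci substitution: 0 ↦ 01, 1 ↦ 02, 2 ↦ 0. -/
def tribo : ℕ → List ℕ
  | 0 => [0, 1]
  | 1 => [0, 2]
  | _ => [0]

/-- `F k = |φ^k(0)|` for the Tribonacci substitution. -/
def triboF (k : ℕ) : ℕ := (iterW tribo k [0]).length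

/-- The square of the Tribonacci substitution, acting on words. -/
def triboSq (w : List ℕ) : List ℕ := substW tribo (substW tribo w)

/-- The word of length `k` occurring in `t` at position `i`. -/
def window (t : ℕ → ℕ) (i k : ℕ) : List ℕ := (List.range k).map (fun j => t (i + j))

/-- The numbers of occurrences of the letters `0`, `1`, `2`. -/
def letterCounts (w : List ℕ) : ℤ × ℤ × ℤ := (w.count 0, w.count 1, w.count 2)

/-- The action of `triboSq` on letter counts. -/
def triboSqMatrix (v : ℤ × ℤ × ℤ) : ℤ × ℤ × ℤ :=
  (2 * v.1 + 2 * v.2.1 + v.2.2, v.1 + v.2.1 + v.2.2, v.1)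

/-- The length of the image under `triboSq` of a word with given letter counts. -/
def triboSqWeight (v : ℤ × ℤ × ℤ) : ℤ := 4 * v.1 + 3 * v.2.1 + 2 * v.2.2

/-- The length of the image under `triboSq` of the prefix of length `x`. -/
def imageLength (t : ℕ → ℕ) (x : ℕ) : ℕ := (triboSq (pref t x)).length

/-- A relative count vector, the letter at which a factor starts, and the letters following it. -/
abbrev WindowState := (ℤ × ℤ × ℤ) × ℕ × List ℕ

/-- The state of the factor of length `n` at position `x`. -/
def windowState (t : ℕ → ℕ) (n x : ℕ) : WindowState :=
  (letterCounts (pref t (x + n)) - letterCounts (pref t x) - letterCounts (pref t n),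
    t x, window t (x + n) 3)

/-- The offset, inside the image of the letters following a factor, at which the factor derived
from it ends. -/
def stepOffset (s : WindowState) (r : ℕ) : ℤ := r + 1 - triboSqWeight s.1

/-- The state of the factor derived from one with state `s`, starting at offset `r` inside the
image of its first letter. -/
def windowStep (s : WindowState) (r : ℕ) : WindowState :=
  (triboSqMatrix s.1 + letterCounts ((triboSq s.2.2).take (stepOffset s r).toNat)
      - letterCounts ((triboSq [s.2.1]).take r) - (1, 0, 0),
    (triboSq [s.2.1]).getD r 0,
    ((triboSq s.2.2).drop (stepOffset s r).toNat).take 3)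

/-- The known letters suffice to compute `windowStep s r`. -/
def StepDefined (s : WindowState) (r : ℕ) : Prop :=
  0 ≤ stepOffset s r ∧ (stepOffset s r).toNat + 3 ≤ (triboSq s.2.2).length

instance (s : WindowState) (r : ℕ) : Decidable (StepDefined s r) :=
  inferInstanceAs (Decidable (_ ∧ _))

/-- The factors of length three of the Tribonacci word. -/
def triboFactors : List (List ℕ) :=
  [[0, 0, 1], [0, 1, 0], [0, 2, 0], [1, 0, 0], [1, 0, 1], [1, 0, 2], [2, 0, 1]]

/-- A set of states closed under `windowStep`. -/
def triboStates : List WindowState :=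
  [((-1, 0, 1), 2, [0, 1, 0]), ((-1, 1, 0), 1, [0, 0, 1]), ((-1, 1, 0), 1, [0, 1, 0]),
    ((-1, 1, 0), 1, [0, 2, 0]), ((-1, 1, 0), 2, [0, 2, 0]), ((0, 0, 0), 0, [0, 0, 1]),
    ((0, 0, 0), 0, [0, 1, 0]), ((0, 0, 0), 0, [0, 2, 0]), ((0, 0, 0), 0, [1, 0, 0]),
    ((0, 0, 0), 0, [1, 0, 1]), ((0, 0, 0), 0, [1, 0, 2]), ((0, 0, 0), 0, [2, 0, 1]),
    ((0, 0, 0), 1, [1, 0, 0]), ((0, 0, 0), 1, [1, 0, 1]), ((0, 0, 0), 1, [1, 0, 2]),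
    ((0, 0, 0), 2, [1, 0, 2]), ((0, 0, 0), 2, [2, 0, 1]), ((0, 1, -1), 0, [0, 2, 0]),
    ((0, 1, -1), 0, [2, 0, 1]), ((0, 1, -1), 1, [2, 0, 1])]

theorem triboStates_step : ∀ s ∈ triboStates, ∀ r < (triboSq [s.2.1]).length,
    StepDefined s r ∧ windowStep s r ∈ triboStates := by
  decide +kernel

theorem triboFactors_step : ∀ f ∈ triboFactors, ∀ r < (triboSq [f.getD 0 0]).length,
    r + 3 ≤ (triboSq f).length ∧ ((triboSq f).drop r).take 3 ∈ triboFactors := by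
  decide +kernel

theorem triboStates_of_factor : ∀ f ∈ triboFactors,
    ((0, 0, 0), f.getD 0 0, f) ∈ triboStates := by
  decide +kernel

theorem triboStates_counts : ∀ s ∈ triboStates,
    s.1 = (0, 0, 0) ∨ s.1 = (-1, 1, 0) ∨ s.1 = (0, 1, -1) ∨ s.1 = (-1, 0, 1) := by
  decide +kernel

theorem substW_append (φ : ℕ → List ℕ) (u v : List ℕ) :
    substW φ (u ++ v) = substW φ u ++ substW φ v := by
  simp [substW]

theorem triboSq_append (u v : List ℕ) : triboSq (u ++ v) = triboSq u ++ triboSq v := by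
  simp [triboSq, substW_append]

theorem letterCounts_append (u v : List ℕ) :
    letterCounts (u ++ v) = letterCounts u + letterCounts v := by
  simp [letterCounts]

theorem triboSq_singleton {a : ℕ} (ha : a < 3) :
    letterCounts (triboSq [a]) = triboSqMatrix (letterCounts [a]) ∧
      ((triboSq [a]).length : ℤ) = triboSqWeight (letterCounts [a]) ∧
      2 ≤ (triboSq [a]).length ∧ (triboSq [a]).take 1 = [0] := by
  interval_cases a <;> decide +kernel

theorem letterCounts_triboSq {w : List ℕ} (hw : ∀ a ∈ w, a < 3) :
    letterCounts (triboSq w) = triboSqMatrix (letterCounts w) ∧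
      ((triboSq w).length : ℤ) = triboSqWeight (letterCounts w) ∧
      2 * w.length ≤ (triboSq w).length := by
  induction w with
  | nil => decide
  | cons a w ih =>
    obtain ⟨h₁, h₂, h₃⟩ := ih fun b hb => hw b (List.mem_cons_of_mem _ hb)
    obtain ⟨k₁, k₂, k₃, -⟩ := triboSq_singleton (hw a List.mem_cons_self)
    have e : a :: w = [a] ++ w := rfl
    rw [e, triboSq_append, letterCounts_append, letterCounts_append, h₁, k₁,
      List.length_append, List.length_append]
    refine ⟨?_, ?_, ?_⟩
    · ext <;> simp [triboSqMatrix] <;> ring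
    · push_cast
      rw [h₂, k₂]
      simp [triboSqWeight]
      ring
    · simp only [List.length_singleton]
      omega

section Window

variable (t : ℕ → ℕ)

@[simp] theorem window_length (i k : ℕ) : (window t i k).length = k := by
  simp [window]

@[simp] theorem pref_length (n : ℕ) : (pref t n).length = n := by
  simp [pref]

theorem window_add (i k l : ℕ) : window t i (k + l) = window t i k ++ window t (i + k) l := by
  simp [window, List.range_add, Function.comp_def, add_assoc]

theorem pref_eq_window (n : ℕ) : pref t n = window t 0 n := by
  simp [pref, window]

theorem pref_add (n k : ℕ) : pref t (n + k) = pref t n ++ window t n k := by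
  simp [pref_eq_window, window_add]

theorem window_one (i : ℕ) : window t i 1 = [t i] := by
  simp [window]

theorem window_take {i k l : ℕ} (h : k ≤ l) : (window t i l).take k = window t i k := by
  obtain ⟨m, rfl⟩ := Nat.exists_eq_add_of_le h
  rw [window_add, List.take_left' (by simp)]

theorem window_drop_take {i k l m : ℕ} (h : k + l ≤ m) :
    ((window t i m).drop k).take l = window t (i + k) l := by
  obtain ⟨p, rfl⟩ := Nat.exists_eq_add_of_le h
  rw [add_assoc, window_add, List.drop_left' (by simp), window_take t (Nat.le_add_right _ _)]

theorem window_getD {i k j : ℕ} (h : j < k) : (window t i k).getD j 0 = t (i + j) := by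
  simp [window, List.getD, h]

end Window

section FixedPoint

variable {t : ℕ → ℕ}

theorem triboSq_window (hG : ∀ x, triboSq (pref t x) = pref t (imageLength t x)) (x k : ℕ) :
    window t (imageLength t x) (triboSq (window t x k)).length = triboSq (window t x k) := by
  have h := hG (x + k)
  have hl : imageLength t (x + k) = imageLength t x + (triboSq (window t x k)).length := by
    simp [imageLength, pref_add, triboSq_append]
  rw [hl, pref_add, pref_add, triboSq_append, hG x] at h
  exact (List.append_cancel_left h).symm

theorem pref_imageLength_add (hG : ∀ x, triboSq (pref t x) = pref t (imageLength t x))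
    {x k o : ℕ} (h : o ≤ (triboSq (window t x k)).length) :
    pref t (imageLength t x + o) = triboSq (pref t x) ++ (triboSq (window t x k)).take o := by
  rw [pref_add, hG, ← triboSq_window hG x k, window_take t h]

theorem window_imageLength_add (hG : ∀ x, triboSq (pref t x) = pref t (imageLength t x))
    {x k o l : ℕ} (h : o + l ≤ (triboSq (window t x k)).length) :
    window t (imageLength t x + o) l = ((triboSq (window t x k)).drop o).take l := by
  rw [← triboSq_window hG x k, window_drop_take t h]

theorem imageLength_succ (x : ℕ) :
    imageLength t (x + 1) = imageLength t x + (triboSq [t x]).length := by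
  simp [imageLength, pref_add, triboSq_append, window_one]

theorem pref_lt (ht : ∀ i, t i < 3) (x : ℕ) : ∀ a ∈ pref t x, a < 3 := by
  intro a ha
  obtain ⟨i, -, rfl⟩ := List.mem_map.1 ha
  exact ht i

theorem exists_eq_imageLength_add (ht : ∀ i, t i < 3) (m : ℕ) :
    ∃ x r, r < (triboSq [t x]).length ∧ m = imageLength t x + r := by
  induction m with
  | zero => exact ⟨0, 0, by have := (triboSq_singleton (ht 0)).2.2.1; omega, rfl⟩
  | succ m ih =>
    obtain ⟨x, r, hr, rfl⟩ := ih
    by_cases h : r + 1 < (triboSq [t x]).length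
    · exact ⟨x, r + 1, h, rfl⟩
    · refine ⟨x + 1, 0, by have := (triboSq_singleton (ht (x + 1))).2.2.1; omega, ?_⟩
      rw [imageLength_succ]
      omega

theorem window_mem_triboFactors (ht : ∀ i, t i < 3)
    (hG : ∀ x, triboSq (pref t x) = pref t (imageLength t x))
    (h0 : window t 0 3 = [0, 1, 0]) (m : ℕ) : window t m 3 ∈ triboFactors := by
  induction m using Nat.strong_induction_on with
  | _ m ih =>
    rcases Nat.eq_zero_or_pos m with rfl | hm
    · rw [h0]
      decide
    · obtain ⟨x, r, hr, rfl⟩ := exists_eq_imageLength_add ht m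
      have hx : 2 * x ≤ imageLength t x := by
        simpa [imageLength] using (letterCounts_triboSq (pref_lt ht x)).2.2
      have hf := ih x (by omega)
      have := triboFactors_step _ hf r (by rw [window_getD t (by norm_num)]; exact hr)
      rw [window_imageLength_add hG this.1]
      exact this.2

theorem windowState_step (ht : ∀ i, t i < 3)
    (hG : ∀ x, triboSq (pref t x) = pref t (imageLength t x)) {n x r : ℕ}
    (hr : r < (triboSq [t x]).length) (hs : StepDefined (windowState t n x) r) :
    windowState t (imageLength t n + 1) (imageLength t x + r) =
      windowStep (windowState t n x) r := by
  obtain ⟨h₁, h₂⟩ := hs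
  set o := (stepOffset (windowState t n x) r).toNat with ho
  have hL (z : ℕ) : (imageLength t z : ℤ) = triboSqWeight (letterCounts (pref t z)) :=
    (letterCounts_triboSq (pref_lt ht z)).2.1
  have hM (z : ℕ) := (letterCounts_triboSq (pref_lt ht z)).1
  have hy : imageLength t x + r + (imageLength t n + 1) = imageLength t (x + n) + o := by
    have : (o : ℤ) = stepOffset (windowState t n x) r := Int.toNat_of_nonneg h₁
    zify
    rw [this, hL, hL, hL]
    simp [stepOffset, windowState, triboSqWeight]
    ring
  have hx : window t x 1 = [t x] := window_one t x
  have h0 : (triboSq (window t n 1)).take 1 = [0] := by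
    rw [window_one]
    exact (triboSq_singleton (ht n)).2.2.2
  have h0' : 1 ≤ (triboSq (window t n 1)).length := by
    rw [window_one]
    have := (triboSq_singleton (ht n)).2.2.1
    omega
  have h₂' : o + 3 ≤ (triboSq (window t (x + n) 3)).length := h₂
  unfold windowStep
  rw [← ho, windowState, hy]
  refine Prod.ext ?_ (Prod.ext ?_ ?_)
  · simp only [windowState]
    rw [pref_imageLength_add hG (k := 3) (by omega),
      pref_imageLength_add hG (x := x) (k := 1) (by rw [hx]; exact hr.le),
      pref_imageLength_add hG (x := n) h0', h0, hx]
    simp only [letterCounts_append, hM]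
    ext <;> simp [triboSqMatrix, letterCounts] <;> ring
  · have := window_getD t (i := imageLength t x) hr
    rw [← hx, triboSq_window hG, hx] at this
    exact this.symm
  · exact window_imageLength_add hG h₂'

end FixedPoint

/-- The lengths of the words obtained from the empty word by iterating `w ↦ triboSq w ++ [0]`
along the prefixes of `t`. -/
def prefixChain (t : ℕ → ℕ) : ℕ → ℕ
  | 0 => 0
  | i + 1 => imageLength t (prefixChain t i) + 1

section Chain

variable {t : ℕ → ℕ}

theorem windowState_mem (ht : ∀ i, t i < 3)
    (hG : ∀ x, triboSq (pref t x) = pref t (imageLength t x))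
    (h0 : window t 0 3 = [0, 1, 0]) (i x : ℕ) :
    windowState t (prefixChain t i) x ∈ triboStates := by
  induction i generalizing x with
  | zero =>
    have := triboStates_of_factor _ (window_mem_triboFactors ht hG h0 x)
    rw [window_getD t (by norm_num)] at this
    simpa [windowState, prefixChain, letterCounts, pref] using this
  | succ i ih =>
    obtain ⟨z, r, hr, rfl⟩ := exists_eq_imageLength_add ht x
    have := triboStates_step _ (ih z) r hr
    rw [prefixChain, windowState_step ht hG hr this.1]
    exact this.2

/-- The state `s` is realized by some factor of length `n`. -/
def Realized (t : ℕ → ℕ) (n : ℕ) (s : WindowState) : Prop := ∃ x, windowState t n x = s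

theorem Realized.step (ht : ∀ i, t i < 3)
    (hG : ∀ x, triboSq (pref t x) = pref t (imageLength t x)) {i : ℕ} {s : WindowState}
    (h : Realized t (prefixChain t i) s) (r : ℕ) (s' : WindowState)
    (hr : r < (triboSq [s.2.1]).length ∧ StepDefined s r ∧ windowStep s r = s') :
    Realized t (prefixChain t (i + 1)) s' := by
  obtain ⟨x, rfl⟩ := h
  exact ⟨imageLength t x + r, (windowState_step ht hG hr.1 hr.2.1).trans hr.2.2⟩

theorem realized_recurrent (ht : ∀ i, t i < 3)
    (hG : ∀ x, triboSq (pref t x) = pref t (imageLength t x))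
    (h0 : window t 0 4 = [0, 1, 0, 2]) (i : ℕ) :
    Realized t (prefixChain t (i + 1)) ((0, 0, 0), 0, [0, 1, 0]) ∧
      Realized t (prefixChain t (i + 1)) ((0, 0, 0), 0, [1, 0, 2]) ∧
      Realized t (prefixChain t (i + 1)) ((-1, 1, 0), 1, [0, 2, 0]) := by
  induction i with
  | zero =>
    have hA : Realized t (prefixChain t 0) ((0, 0, 0), 0, [0, 1, 0]) := by
      refine ⟨0, ?_⟩
      simp [window, List.range_succ] at h0
      simp [windowState, prefixChain, window, List.range_succ, h0, letterCounts, pref]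
    have hB : Realized t (prefixChain t 0) ((0, 0, 0), 1, [1, 0, 2]) := by
      refine ⟨1, ?_⟩
      simp [window, List.range_succ] at h0
      simp [windowState, prefixChain, window, List.range_succ, h0, letterCounts, pref]
    exact ⟨hB.step ht hG 2 _ (by decide +kernel), hA.step ht hG 0 _ (by decide +kernel),
      hA.step ht hG 1 _ (by decide +kernel)⟩
  | succ i ih =>
    obtain ⟨hA, hB, -⟩ := ih
    exact ⟨hB.step ht hG 2 _ (by decide +kernel), hA.step ht hG 0 _ (by decide +kernel),
      hA.step ht hG 1 _ (by decide +kernel)⟩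

theorem mem_relParikhSet_iff (n : ℕ) (v : Fin 3 → ℤ) :
    v ∈ relParikhSet 3 t n ↔ ∃ x, (windowState t n x).1 = (v 0, v 1, v 2) := by
  have key (x : ℕ) : v = parikh 3 (window t x n) - parikh 3 (pref t n) ↔
      (windowState t n x).1 = (v 0, v 1, v 2) := by
    rw [windowState, pref_add, letterCounts_append]
    simp [funext_iff, Fin.forall_fin_succ, Prod.ext_iff, parikh, letterCounts, eq_comm]
  constructor
  · rintro ⟨w, ⟨x, hx⟩, rfl, hv⟩
    exact ⟨x, (key x).1 (by rw [hv]; congr 2)⟩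
  · rintro ⟨x, hx⟩
    exact ⟨window t x n, ⟨x, by simp [window]⟩, by simp, (key x).2 hx⟩

theorem relParikhSet_prefixChain (ht : ∀ i, t i < 3)
    (hG : ∀ x, triboSq (pref t x) = pref t (imageLength t x))
    (h0 : window t 0 4 = [0, 1, 0, 2]) (i : ℕ) :
    relParikhSet 3 t (prefixChain t (i + 2)) =
      ({![0, 0, 0], ![-1, 1, 0], ![0, 1, -1], ![-1, 0, 1]} : Set (Fin 3 → ℤ)) := by
  have h3 : window t 0 3 = [0, 1, 0] := by
    rw [← window_take t (show 3 ≤ 4 by norm_num), h0]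
    rfl
  ext v
  rw [mem_relParikhSet_iff]
  have hv (a b c : ℤ) : v = ![a, b, c] ↔ (v 0, v 1, v 2) = (a, b, c) := by
    simp [funext_iff, Fin.forall_fin_succ]
  simp only [Set.mem_insert_iff, Set.mem_singleton_iff, hv]
  constructor
  · rintro ⟨x, hx⟩
    rw [← hx]
    exact triboStates_counts _ (windowState_mem ht hG h3 _ x)
  · obtain ⟨hA, -, hC⟩ := realized_recurrent ht hG h0 i
    obtain ⟨x, hx⟩ := (realized_recurrent ht hG h0 (i + 1)).1
    obtain ⟨y, hy⟩ := (realized_recurrent ht hG h0 (i + 1)).2.2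
    obtain ⟨z, hz⟩ := hC.step ht hG 0 ((0, 1, -1), 0, [0, 2, 0]) (by decide +kernel)
    obtain ⟨u, hu⟩ := hA.step ht hG 3 ((-1, 0, 1), 2, [0, 1, 0]) (by decide +kernel)
    rintro (h | h | h | h) <;> rw [h]
    exacts [⟨x, by rw [hx]⟩, ⟨y, by rw [hy]⟩, ⟨z, by rw [hz]⟩, ⟨u, by rw [hu]⟩]

theorem pref_prefixChain_succ (ht : ∀ i, t i < 3)
    (hG : ∀ x, triboSq (pref t x) = pref t (imageLength t x)) (i : ℕ) :
    pref t (prefixChain t (i + 1)) = triboSq (pref t (prefixChain t i)) ++ [0] := by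
  obtain ⟨-, -, h, h'⟩ := triboSq_singleton (ht (prefixChain t i))
  rw [← window_one] at h h'
  rw [prefixChain, pref_imageLength_add hG (k := 1) (by omega), h']

theorem pref_prefixChain_eq_append (ht : ∀ i, t i < 3)
    (hG : ∀ x, triboSq (pref t x) = pref t (imageLength t x)) (i : ℕ) :
    pref t (prefixChain t (i + 1)) =
      iterW tribo (2 * i) [0] ++ pref t (prefixChain t i) := by
  induction i with
  | zero =>
    rw [pref_prefixChain_succ ht hG]
    rfl
  | succ i ih =>
    have h : iterW tribo (2 * (i + 1)) [0] = triboSq (iterW tribo (2 * i) [0]) := by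
      rw [mul_add, iterW, add_comm, Function.iterate_add_apply]
      rfl
    conv_lhs => rw [pref_prefixChain_succ ht hG, ih, triboSq_append, List.append_assoc,
      ← pref_prefixChain_succ ht hG, ← h]

theorem prefixChain_eq_sum (ht : ∀ i, t i < 3)
    (hG : ∀ x, triboSq (pref t x) = pref t (imageLength t x)) (i : ℕ) :
    prefixChain t i = ∑ j ∈ Finset.range i, triboF (2 * j) := by
  induction i with
  | zero => rfl
  | succ i ih =>
    have := congrArg List.length (pref_prefixChain_eq_append ht hG i)
    rw [List.length_append, pref_length, pref_length] at this
    rw [Finset.sum_range_succ, ← ih, this, add_comm, triboF]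

end Chain

theorem iterW_append (φ : ℕ → List ℕ) (k : ℕ) (u v : List ℕ) :
    iterW φ k (u ++ v) = iterW φ k u ++ iterW φ k v := by
  induction k generalizing u v with
  | zero => rfl
  | succ k ih => simpa [iterW, substW_append] using ih (substW φ u) (substW φ v)

theorem length_le_length_substW_tribo (w : List ℕ) : w.length ≤ (substW tribo w).length := by
  induction w with
  | nil => simp
  | cons a w ih =>
    have : 1 ≤ (tribo a).length := by
      unfold tribo
      split <;> simp
    simp only [substW, List.flatMap_cons, List.length_append, List.length_cons] at ih ⊢
    omega

theorem length_le_length_iterW_tribo (k : ℕ) (w : List ℕ) :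
    w.length ≤ (iterW tribo k w).length := by
  induction k generalizing w with
  | zero => exact le_rfl
  | succ k ih => exact (length_le_length_substW_tribo w).trans (ih _)

theorem lt_length_iterW_tribo (k : ℕ) : k < (iterW tribo k [0]).length := by
  induction k with
  | zero => simp [iterW]
  | succ k ih =>
    have h : iterW tribo (k + 1) [0] = iterW tribo k ([0] ++ [1]) := rfl
    have := length_le_length_iterW_tribo k [1]
    rw [h, iterW_append, List.length_append]
    simp only [List.length_singleton] at this
    omega

theorem triboSq_pref {t : ℕ → ℕ}
    (htfix : ∀ k : ℕ, iterW tribo k [0] = pref t (iterW tribo k [0]).length) (x : ℕ) :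
    triboSq (pref t x) = pref t (imageLength t x) := by
  obtain ⟨m, hm⟩ := Nat.exists_eq_add_of_le (lt_length_iterW_tribo x).le
  have h : triboSq (iterW tribo x [0]) = iterW tribo (2 + x) [0] := by
    rw [iterW, iterW, Function.iterate_add_apply]
    rfl
  have h' := htfix (2 + x)
  rw [← h, htfix x, hm, pref_add, triboSq_append, List.length_append, pref_add] at h'
  exact (List.append_inj h' (by simp)).1

theorem stmt15 (t : ℕ → ℕ) (ht : ∀ i, t i < 3)
    (htfix : ∀ k : ℕ, iterW tribo k [0] = pref t (iterW tribo k [0]).length)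
    (n : ℕ → ℕ) (hn : ∀ i, n i = ∑ j ∈ Finset.range (i + 1), triboF (2 * j)) :
    (∀ i : ℕ, 1 ≤ i →
      relParikhSet 3 t (n i) =
        ({![0, 0, 0], ![-1, 1, 0], ![0, 1, -1], ![-1, 0, 1]} : Set (Fin 3 → ℤ)) ∧
      (relParikhSet 3 t (n i)).ncard = 4) ∧
    { N : ℕ | (relParikhSet 3 t N).ncard = 4 }.Infinite := by
  have hG := triboSq_pref htfix
  have h0 : window t 0 4 = [0, 1, 0, 2] := by
    rw [← pref_eq_window]
    exact (htfix 2).symm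
  have main (i : ℕ) (hi : 1 ≤ i) : relParikhSet 3 t (n i) =
        ({![0, 0, 0], ![-1, 1, 0], ![0, 1, -1], ![-1, 0, 1]} : Set (Fin 3 → ℤ)) ∧
      (relParikhSet 3 t (n i)).ncard = 4 := by
    obtain ⟨i, rfl⟩ := Nat.exists_eq_add_of_le' hi
    have h := relParikhSet_prefixChain ht hG h0 i
    rw [prefixChain_eq_sum ht hG, ← hn] at h
    refine ⟨h, ?_⟩
    have hc : ({![0, 0, 0], ![-1, 1, 0], ![0, 1, -1], ![-1, 0, 1]} : Finset (Fin 3 → ℤ)).card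
        = 4 := by decide
    rw [h, ← hc, ← Set.ncard_coe_finset]
    simp
  refine ⟨main, ?_⟩
  have hmono : StrictMono n := strictMono_nat_of_lt_succ fun i => by
    rw [hn, hn, Finset.sum_range_succ _ (i + 1)]
    have : 2 * (i + 1) < triboF (2 * (i + 1)) := lt_length_iterW_tribo _
    omega
  refine Set.infinite_of_injective_forall_mem (f := fun i => n (i + 1))
    (fun i j h => by simpa using hmono.injective h) fun i => (main (i + 1) (by omega)).2
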